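/- arXiv:1908.03228 — 3 statements merged into one kernel-verified Lean document; each statement's English description precedes it below -/
import Mathlib

section
/- Let (A,+) be a group and G a regular subgroup of Hol(A,+). Define a∘b = a + f(b) where (a,f) is the unique element of G whose first component is a. Then (A,+,∘) is a skew brace and (A,∘) is isomorphic to G. -/
/-- `(op, e, inv)` is a group structure on `A`. -/
def IsGroupOp {A : Type*} (op : A → A → A) (e : A) (inv : A → A) : Prop :=
  (∀ a b c, op (op a b) c = op a (op b c)) ∧ (∀ a, op e a = a) ∧ (∀ a, op a e = a) ∧
  (∀ a, op (inv a) a = e) ∧ (∀ a, op a (inv a) = e)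

/-- `(A, add, mul)` is a skew left brace: both operations are group operations and
`a ∘ (b + c) = (a ∘ b - a) + a ∘ c`. -/
def IsSkewBrace {A : Type*} (add : A → A → A) (zero : A) (neg : A → A)
    (mul : A → A → A) (one : A) (inv : A → A) : Prop :=
  IsGroupOp add zero neg ∧ IsGroupOp mul one inv ∧
  ∀ a b c, mul a (add b c) = add (add (mul a b) (neg a)) (mul a c)

/-- `g : A → A` is an element of the holomorph `Hol(A,+)`, viewed as a permutation
of `A` via `(a,f)(b) = a + f(b)`. Note that the first component is `a = g zero`. -/
def InHol {A : Type*} (add : A → A → A) (g : A → A) : Prop :=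
  ∃ (a : A) (f : A → A), Function.Bijective f ∧
    (∀ x y, f (add x y) = add (f x) (f y)) ∧ ∀ x, g x = add a (f x)

/-- An element of the holomorph satisfies `g (b + c) = (g b - g 0) + g c`. -/
theorem InHol.map_add {A : Type*} {add : A → A → A} {zero : A} {neg : A → A}
    (hgrp : IsGroupOp add zero neg) {g : A → A} (hg : InHol add g) (b c : A) :
    g (add b c) = add (add (g b) (neg (g zero))) (g c) := by
  obtain ⟨hassoc, hzero_add, hadd_zero, hneg_add, -⟩ := hgrp
  obtain ⟨a, f, -, hf, hgf⟩ := hg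
  have hf0 : f zero = zero := by
    have h := congrArg (add (neg (f zero))) (hf zero zero)
    rwa [hzero_add, ← hassoc, hneg_add, hzero_add, eq_comm] at h
  have hg0 : g zero = a := by rw [hgf, hf0, hadd_zero]
  rw [hg0, hgf, hgf, hgf, hf, hassoc (add a (f b)), ← hassoc (neg a), hneg_add, hzero_add, hassoc]

/-- Let `(A,+)` be a group and `G` a regular subgroup of `Hol(A,+)`.  Defining
`a ∘ b = a + f(b)` where `(a,f)` is the unique element of `G` with first component `a`
(equivalently `a ∘ b = g b` for the unique `g ∈ G` with `g 0 = a`), the triple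
`(A,+,∘)` is a skew brace and `(A,∘)` is isomorphic to `G`. -/
theorem stmt5 {A : Type*} (add : A → A → A) (zero : A) (neg : A → A)
    (hgrp : IsGroupOp add zero neg)
    (G : Set (A → A))
    (hhol : ∀ g ∈ G, InHol add g)
    (hid : id ∈ G)
    (hcomp : ∀ g ∈ G, ∀ g' ∈ G, (g ∘ g') ∈ G)
    (hinv : ∀ g ∈ G, ∃ g' ∈ G, g ∘ g' = id ∧ g' ∘ g = id)
    (hreg : ∀ x y : A, ∃! g : A → A, g ∈ G ∧ g x = y)
    (circ : A → A → A)
    (hcirc : ∀ g ∈ G, ∀ b, circ (g zero) b = g b) :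
    (∃ (one : A) (inv : A → A), IsSkewBrace add zero neg circ one inv) ∧
    (∃ e : A → (A → A), (∀ a, e a ∈ G) ∧ (∀ g ∈ G, ∃! a, e a = g) ∧
      ∀ a b, e (circ a b) = e a ∘ e b) := by
  choose e he huniq using hreg zero
  have he_mem a : e a ∈ G := (he a).1
  have he_zero a : e a zero = a := (he a).2
  have he_eq {g : A → A} (hg : g ∈ G) : e (g zero) = g := (huniq _ g ⟨hg, rfl⟩).symm
  have hcirc_eq a b : circ a b = e a b := by
    have h := hcirc _ (he_mem a) b
    rwa [he_zero] at h
  have he_circ a b : e (circ a b) = e a ∘ e b := by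
    have h := he_eq (hcomp _ (he_mem a) _ (he_mem b))
    rwa [Function.comp_apply, he_zero, ← hcirc_eq] at h
  have he_id : e zero = id := he_eq hid
  choose k hk_mem hk_right hk_left using fun a => hinv (e a) (he_mem a)
  refine ⟨⟨zero, fun a => k a zero, hgrp, ⟨?_, ?_, ?_, ?_, ?_⟩, ?_⟩, e, he_mem, ?_, he_circ⟩
  · intro a b c
    rw [hcirc_eq (circ a b), he_circ, Function.comp_apply, ← hcirc_eq, ← hcirc_eq]
  · intro a
    rw [hcirc_eq, he_id, id]
  · intro a
    rw [hcirc_eq, he_zero]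
  · intro a
    have h := congrFun (hk_left a) zero
    rwa [Function.comp_apply, he_zero, ← hcirc _ (hk_mem a)] at h
  · intro a
    rw [hcirc_eq]
    exact congrFun (hk_right a) zero
  · intro a b c
    have h := (hhol _ (he_mem a)).map_add hgrp b c
    rwa [he_zero, ← hcirc_eq, ← hcirc_eq, ← hcirc_eq] at h
  · intro g hg
    refine ⟨g zero, he_eq hg, ?_⟩
    rintro a rfl
    exact (he_zero a).symm
end

section
/- Let p > q be primes with p ≡ 1 (mod q), M = ℤ_p ⋊_g ℤ_q, and a₀ an inverse of g-1 mod p. The regular subgroups of Hol(M) whose image under π₂ has size p are exactly G_c = ⟨σ^{a₀}α, σ^c τ⟩ for 0 ≤ c ≤ p-1, each isomorphic to the cyclic group of order pq; moreover all these G_c are conjugate under Aut(M), via φ_{1,-c} G_c φ_{1,-c}^{-1} = G_0. -/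
/-- The holomorph `Hol(A) = A ⋊ Aut(A)` of a group `A`, viewed as the set of
permutations of `A` of the form `x ↦ a · f(x)` with `f` an automorphism. -/
def HolSet (A : Type*) [Group A] : Set (Equiv.Perm A) :=
  {g | ∃ (a : A) (f : A ≃* A), ∀ x, g x = a * f x}

/-- The projection `π₂ : Hol(A) → Aut(A)`. -/
def holPi2 {A : Type*} [Group A] (g : Equiv.Perm A) : A → A :=
  fun x => (g 1)⁻¹ * g x

/-- A subgroup of permutations of `A` is regular if its action is simply transitive. -/
def IsRegularPermGroup {A : Type*} (G : Subgroup (Equiv.Perm A)) : Prop :=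
  ∀ x y : A, ∃! g : Equiv.Perm A, g ∈ G ∧ g x = y

section

variable {p q : ℕ} (φ : Multiplicative (ZMod q) →* MulAut (Multiplicative (ZMod p)))

/-- The generator `σ` of `M = ℤ_p ⋊[φ] ℤ_q`. -/
def σM : Multiplicative (ZMod p) ⋊[φ] Multiplicative (ZMod q) :=
  SemidirectProduct.inl (Multiplicative.ofAdd (1 : ZMod p))

/-- The generator `τ` of `M = ℤ_p ⋊[φ] ℤ_q`. -/
def τM : Multiplicative (ZMod p) ⋊[φ] Multiplicative (ZMod q) :=
  SemidirectProduct.inr (Multiplicative.ofAdd (1 : ZMod q))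

/-- The subgroup `G_c = ⟨σ^{a₀}α, σ^c τ⟩` of `Hol(M) ≤ Perm(M)`, where elements of
`Hol(M)` are viewed as permutations `x ↦ m · f(x)`. -/
def Gc (α : MulAut (Multiplicative (ZMod p) ⋊[φ] Multiplicative (ZMod q)))
    (a₀ : ZMod p) (c : ℕ) :
    Subgroup (Equiv.Perm (Multiplicative (ZMod p) ⋊[φ] Multiplicative (ZMod q))) :=
  Subgroup.closure
    {Equiv.mulLeft ((σM φ) ^ a₀.val) * α.toEquiv,
      Equiv.mulLeft ((σM φ) ^ c * τM φ)}

end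

open SemidirectProduct Multiplicative

section General

variable {N H : Type*} [CommGroup N] [Group H] {φ : H →* MulAut N}

/-- The action of `N × H` on `N ⋊[φ] H` where `N` acts by right translations and `H` acts by
left translations through its conjugate by `u`. -/
def twoSidedTranslation (u : N ⋊[φ] H) : N × H →* Equiv.Perm (N ⋊[φ] H) where
  toFun s := Equiv.mulLeft (u * inr s.2 * u⁻¹) * Equiv.mulRight (inl s.1)
  map_one' := by ext1 x; simp
  map_mul' s t := by
    ext1 x
    simp [mul_assoc, mul_comm s.1 t.1]

theorem twoSidedTranslation_apply (u : N ⋊[φ] H) (s : N × H) (x : N ⋊[φ] H) :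
    twoSidedTranslation u s x = u * inr s.2 * u⁻¹ * (x * inl s.1) := rfl

theorem existsUnique_twoSidedTranslation_apply_eq (u x y : N ⋊[φ] H) :
    ∃! s : N × H, twoSidedTranslation u s x = y := by
  have key : ∀ s : N × H, twoSidedTranslation u s x = y ↔
      inr s.2 * (u⁻¹ * x) * inl s.1 = u⁻¹ * y := by
    intro s
    rw [twoSidedTranslation_apply, eq_inv_mul_iff_mul_eq]
    simp only [mul_assoc]
  simp only [key]
  generalize u⁻¹ * x = z
  generalize u⁻¹ * y = w
  have key₂ : ∀ s : N × H, inr s.2 * z * inl s.1 = w ↔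
      inl s.1 = (inr s.2 * z)⁻¹ * w := by
    intro s
    rw [eq_inv_mul_iff_mul_eq]
  refine ⟨(((inr (w.right * z.right⁻¹) * z)⁻¹ * w).left, w.right * z.right⁻¹), ?_, ?_⟩
  · ext <;> simp
  · rintro ⟨s, t⟩ h
    have ht : t = w.right * z.right⁻¹ := by
      rw [← h]; simp
    subst ht
    rw [key₂] at h
    ext
    · simp only [← h, left_inl]
    · rfl

theorem twoSidedTranslation_injective (u : N ⋊[φ] H) :
    Function.Injective (twoSidedTranslation u) := fun s t h =>
  (existsUnique_twoSidedTranslation_apply_eq u 1 (twoSidedTranslation u t 1)).unique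
    (by rw [h]) rfl

theorem isRegularPermGroup_range_twoSidedTranslation (u : N ⋊[φ] H) :
    IsRegularPermGroup (twoSidedTranslation u).range := by
  intro x y
  obtain ⟨s, hs, hu⟩ := existsUnique_twoSidedTranslation_apply_eq u x y
  refine ⟨_, ⟨⟨s, rfl⟩, hs⟩, ?_⟩
  rintro _ ⟨⟨t, rfl⟩, ht⟩
  rw [hu t ht]

theorem range_twoSidedTranslation_subset_holSet (u : N ⋊[φ] H) :
    ((twoSidedTranslation u).range : Set (Equiv.Perm (N ⋊[φ] H))) ⊆ HolSet _ := by
  rintro _ ⟨s, rfl⟩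
  refine ⟨u * inr s.2 * u⁻¹ * inl s.1, MulAut.conj (inl s.1)⁻¹, fun x => ?_⟩
  simp [twoSidedTranslation_apply, mul_assoc]

theorem holPi2_twoSidedTranslation (u : N ⋊[φ] H) (s : N × H) :
    holPi2 (twoSidedTranslation u s) = MulAut.conj (inl s.1)⁻¹ := by
  ext1 x
  simp [holPi2, twoSidedTranslation_apply, mul_assoc]

theorem map_conj_range_twoSidedTranslation (n : N) :
    (twoSidedTranslation (inl n : N ⋊[φ] H)).range.map
      (MulAut.conj (MulAut.conj (inl n)⁻¹ : MulAut (N ⋊[φ] H)).toEquiv).toMonoidHom =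
      (twoSidedTranslation (1 : N ⋊[φ] H)).range := by
  rw [← MonoidHom.range_comp]
  congr 1
  ext1 s
  ext1 x
  have h : (inl n : N ⋊[φ] H)⁻¹ * (inl s.1 * inl n) = inl s.1 := by
    rw [← map_mul, mul_comm, map_mul, inv_mul_cancel_left]
  change (MulAut.conj (inl n)⁻¹ : MulAut (N ⋊[φ] H)) (twoSidedTranslation (inl n) s
    ((MulAut.conj (inl n)⁻¹ : MulAut (N ⋊[φ] H))⁻¹ x)) = _
  simp [twoSidedTranslation_apply, mul_assoc, h]

/-- Nested regular permutation groups are equal. -/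
theorem IsRegularPermGroup.eq_of_le {A : Type*} [Nonempty A] {G K : Subgroup (Equiv.Perm A)}
    (hK : IsRegularPermGroup K) (hG : IsRegularPermGroup G) (h : K ≤ G) : G = K := by
  refine le_antisymm (fun x hx => ?_) h
  let a : A := Classical.arbitrary A
  obtain ⟨k, ⟨hk, hka⟩, -⟩ := hK a (x a)
  rwa [(hG a (x a)).unique ⟨hx, rfl⟩ ⟨h hk, hka⟩]

theorem IsRegularPermGroup.natCard_eq {A : Type*} [Nonempty A] {G : Subgroup (Equiv.Perm A)}
    (hG : IsRegularPermGroup G) : Nat.card G = Nat.card A := by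
  let a : A := Classical.arbitrary A
  refine Nat.card_congr (Equiv.ofBijective (fun g : G => g.1 a) ⟨fun g k h => ?_, fun y => ?_⟩)
  · exact Subtype.ext ((hG a (g.1 a)).unique ⟨g.2, rfl⟩ ⟨k.2, h.symm⟩)
  · obtain ⟨k, ⟨hk, hka⟩, -⟩ := hG a y
    exact ⟨⟨k, hk⟩, hka⟩

/-- On a subgroup of the holomorph, the projection to automorphisms is a homomorphism. -/
theorem exists_hom_of_subset_holSet {A : Type*} [Group A] (G : Subgroup (Equiv.Perm A))
    (hG : (G : Set (Equiv.Perm A)) ⊆ HolSet A) :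
    ∃ F : G →* MulAut A, ∀ (k : G) (x : A), k.1 x = k.1 1 * F k x := by
  have h : ∀ k : G, ∃ f : MulAut A, ∀ x, k.1 x = k.1 1 * f x := by
    rintro ⟨k, hk⟩
    obtain ⟨a, f, hf⟩ := hG hk
    exact ⟨f, fun x => by simp only [hf, map_one, mul_one]⟩
  choose F hF using h
  refine ⟨MonoidHom.mk' F fun k l => ?_, hF⟩
  ext1 x
  have h₁ := hF (k * l) x
  have h₂ := hF k (l.1 x)
  rw [hF l x, map_mul (F k), ← mul_assoc, ← hF k (l.1 1), ← hF l x] at h₂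
  exact mul_left_cancel (h₁.symm.trans h₂)

end General

section Metacyclic

variable {p q : ℕ} {φ : Multiplicative (ZMod q) →* MulAut (Multiplicative (ZMod p))}

theorem σM_pow (c : ℕ) : σM φ ^ c = inl (ofAdd (c : ZMod p)) := by
  rw [σM, ← map_pow, ← ofAdd_nsmul, nsmul_one]

theorem τM_pow (c : ℕ) : τM φ ^ c = inr (ofAdd (c : ZMod q)) := by
  rw [τM, ← map_pow, ← ofAdd_nsmul, nsmul_one]

theorem mulAut_ext_generators [NeZero p] [NeZero q]
    {α β : MulAut (Multiplicative (ZMod p) ⋊[φ] Multiplicative (ZMod q))}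
    (hσ : α (σM φ) = β (σM φ)) (hτ : α (τM φ) = β (τM φ)) : α = β := by
  ext1 x
  have hx : x = σM φ ^ (toAdd x.left).val * τM φ ^ (toAdd x.right).val := by
    rw [σM_pow, τM_pow, ZMod.natCast_zmod_val, ZMod.natCast_zmod_val]
    exact (inl_left_mul_inr_right x).symm
  rw [hx, map_mul, map_mul, map_pow, map_pow, map_pow, map_pow, hσ, hτ]

theorem closure_generators_eq_top [NeZero p] [NeZero q] {a b : ZMod p} (hab : b * a = 1) :
    Subgroup.closure {(ofAdd a, (1 : Multiplicative (ZMod q))), (1, ofAdd (1 : ZMod q))} = ⊤ := by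
  rw [eq_top_iff]
  rintro ⟨s, t⟩ -
  have h : (s, t) = (ofAdd a, (1 : Multiplicative (ZMod q))) ^ (toAdd s * b).val *
      (1, ofAdd (1 : ZMod q)) ^ (toAdd t).val := by
    ext
    · simp only [Prod.fst_mul, Prod.pow_fst, one_pow, mul_one, ← ofAdd_nsmul, nsmul_eq_mul,
        ZMod.natCast_zmod_val, mul_assoc, hab, ofAdd_toAdd]
    · simp [← ofAdd_nsmul]
  rw [h]
  exact mul_mem (pow_mem (Subgroup.subset_closure (by simp)) _)
    (pow_mem (Subgroup.subset_closure (by simp)) _)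

theorem action_one_eq [Fact (1 < q)] {g : ZMod p}
    (hφ : ∀ (m : ZMod q) (n : ZMod p), φ (ofAdd m) (ofAdd n) = ofAdd (g ^ m.val * n))
    (n : ZMod p) : φ (ofAdd 1) (ofAdd n) = ofAdd (g * n) := by
  rw [hφ, ZMod.val_one, pow_one]

theorem conj_inl_σM (n : Multiplicative (ZMod p)) : MulAut.conj (inl n) (σM φ) = σM φ := by
  rw [MulAut.conj_apply, σM, ← map_inv, ← map_mul, ← map_mul, mul_inv_cancel_comm]

theorem conj_inl_τM [Fact (1 < q)] {g : ZMod p}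
    (hφ : ∀ (m : ZMod q) (n : ZMod p), φ (ofAdd m) (ofAdd n) = ofAdd (g ^ m.val * n))
    (n : ZMod p) :
    MulAut.conj (inl (ofAdd n)) (τM φ) = inl (ofAdd ((1 - g) * n)) * τM φ := by
  rw [MulAut.conj_apply, τM]
  ext
  · simp [← ofAdd_neg, action_one_eq hφ, ← ofAdd_add]
    ring
  · simp

theorem Gc_eq_range [Fact (1 < q)] [NeZero p] [NeZero q] {g : ZMod p}
    (hφ : ∀ (m : ZMod q) (n : ZMod p), φ (ofAdd m) (ofAdd n) = ofAdd (g ^ m.val * n))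
    {a₀ : ZMod p} (ha : (g - 1) * a₀ = 1)
    {α : MulAut (Multiplicative (ZMod p) ⋊[φ] Multiplicative (ZMod q))}
    (hα₁ : α (σM φ) = σM φ) (hα₂ : α (τM φ) = σM φ * τM φ) (c : ℕ) :
    Gc φ α a₀ c = (twoSidedTranslation (inl (ofAdd (-(a₀ * c))))).range := by
  have hα : α = MulAut.conj (inl (ofAdd a₀))⁻¹ := by
    apply mulAut_ext_generators
    · rw [hα₁, ← map_inv, conj_inl_σM]
    · rw [hα₂, ← map_inv, ← ofAdd_neg, conj_inl_τM hφ, σM]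
      congr 3
      linear_combination -ha
  rw [MonoidHom.range_eq_map, ← closure_generators_eq_top ha, MonoidHom.map_closure,
    Set.image_pair, Gc]
  congr 2
  · ext1 x
    simp [twoSidedTranslation_apply, hα, σM_pow, mul_assoc]
  · have h := conj_inl_τM hφ (-(a₀ * c))
    rw [MulAut.conj_apply, τM] at h
    congr 1
    ext1 x
    rw [twoSidedTranslation_apply, h, σM_pow, τM]
    simp only [Equiv.coe_mulLeft, map_one, mul_one]
    congr 4
    linear_combination -c * ha

theorem natCard_holPi2_image_range [Fact (1 < q)] [NeZero p] {g : ZMod p}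
    (hφ : ∀ (m : ZMod q) (n : ZMod p), φ (ofAdd m) (ofAdd n) = ofAdd (g ^ m.val * n))
    {a₀ : ZMod p} (ha : (g - 1) * a₀ = 1)
    (u : Multiplicative (ZMod p) ⋊[φ] Multiplicative (ZMod q)) :
    Nat.card (holPi2 '' ((twoSidedTranslation u).range :
      Set (Equiv.Perm (Multiplicative (ZMod p) ⋊[φ] Multiplicative (ZMod q))))) = p := by
  have h : holPi2 '' ((twoSidedTranslation u).range :
      Set (Equiv.Perm (Multiplicative (ZMod p) ⋊[φ] Multiplicative (ZMod q)))) =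
      Set.range fun (n : ZMod p) (x : Multiplicative (ZMod p) ⋊[φ] Multiplicative (ZMod q)) =>
        MulAut.conj (inl (ofAdd n)) x := by
    ext f
    constructor
    · rintro ⟨_, ⟨s, rfl⟩, rfl⟩
      refine ⟨-toAdd s.1, ?_⟩
      rw [holPi2_twoSidedTranslation, ← map_inv]
      rfl
    · rintro ⟨n, rfl⟩
      refine ⟨_, ⟨(ofAdd (-n), 1), rfl⟩, ?_⟩
      rw [holPi2_twoSidedTranslation, ← map_inv, ← ofAdd_neg, neg_neg]
  rw [h, Nat.card_range_of_injective, Nat.card_zmod]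
  intro m n hmn
  have := congrFun hmn (τM φ)
  simp only [conj_inl_τM hφ] at this
  have := ofAdd.injective (inl_injective (mul_right_cancel this))
  linear_combination (n - m) * ha - a₀ * this

theorem nontrivial_of_prime_natCard {A : Type*} (h : (Nat.card A).Prime) : Nontrivial A :=
  have := Nat.finite_of_card_ne_zero h.ne_zero
  Finite.one_lt_card_iff_nontrivial.mp h.one_lt

theorem eq_inl_of_pow_eq_one (hpq : p.Coprime q)
    {x : Multiplicative (ZMod p) ⋊[φ] Multiplicative (ZMod q)} (hx : x ^ p = 1) :
    ∃ n : ZMod p, x = inl (ofAdd n) := by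
  have h₁ : x.right ^ p = 1 := by
    rw [← rightHom_eq_right, ← map_pow, hx, map_one]
  have h₂ : x.right ^ q = 1 := by
    rw [← ofAdd_toAdd x.right, ← ofAdd_nsmul, nsmul_eq_mul, CharP.cast_eq_zero, zero_mul,
      ofAdd_zero]
  have h₃ : x.right = 1 := by
    have h := pow_gcd_eq_one.mpr ⟨h₁, h₂⟩
    rwa [hpq, pow_one] at h
  exact ⟨toAdd x.left, SemidirectProduct.ext rfl h₃⟩

theorem σM_pow_card : σM φ ^ p = 1 := by
  rw [σM_pow, CharP.cast_eq_zero, ofAdd_zero, map_one]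

theorem mulAut_apply_inl [NeZero p]
    {f : MulAut (Multiplicative (ZMod p) ⋊[φ] Multiplicative (ZMod q))} {i : ZMod p}
    (hi : f (σM φ) = inl (ofAdd i)) (n : ZMod p) :
    f (inl (ofAdd n)) = inl (ofAdd (n * i)) := by
  have h := σM_pow (φ := φ) n.val
  rw [ZMod.natCast_zmod_val] at h
  rw [← h, map_pow, hi, ← map_pow, ← ofAdd_nsmul, nsmul_eq_mul, ZMod.natCast_zmod_val]

theorem mulAut_pow_σM [NeZero p]
    {f : MulAut (Multiplicative (ZMod p) ⋊[φ] Multiplicative (ZMod q))} {i : ZMod p}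
    (hi : f (σM φ) = inl (ofAdd i)) (k : ℕ) : (f ^ k) (σM φ) = inl (ofAdd (i ^ k)) := by
  induction k with
  | zero => rw [pow_zero, pow_zero]; rfl
  | succ k ih => rw [pow_succ', MulAut.mul_apply, ih, mulAut_apply_inl hi, pow_succ]

theorem mulAut_pow_τM [NeZero p]
    {f : MulAut (Multiplicative (ZMod p) ⋊[φ] Multiplicative (ZMod q))} {j : ZMod p}
    (hσ : f (σM φ) = σM φ) (hτ : f (τM φ) = inl (ofAdd j) * τM φ) (k : ℕ) :
    (f ^ k) (τM φ) = inl (ofAdd (k * j)) * τM φ := by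
  induction k with
  | zero => simp
  | succ k ih =>
    rw [pow_succ', MulAut.mul_apply, ih, map_mul, hτ, mulAut_apply_inl hσ, ← mul_assoc, ← map_mul,
      ← ofAdd_add]
    congr 4
    push_cast
    ring

/-- Automorphisms of order dividing `p` fix `σ` and map `τ` to some `σ ^ j * τ`. -/
theorem mulAut_apply_generators_of_pow_eq_one [Fact p.Prime] [Fact q.Prime] (hpq : p.Coprime q)
    {g : ZMod p} (hg : orderOf g = q)
    (hφ : ∀ (m : ZMod q) (n : ZMod p), φ (ofAdd m) (ofAdd n) = ofAdd (g ^ m.val * n))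
    {f : MulAut (Multiplicative (ZMod p) ⋊[φ] Multiplicative (ZMod q))} (hf : f ^ p = 1) :
    f (σM φ) = σM φ ∧ ∃ j : ZMod p, f (τM φ) = inl (ofAdd j) * τM φ := by
  have : Fact (1 < q) := ⟨(Fact.out : q.Prime).one_lt⟩
  have hσ : f (σM φ) = σM φ := by
    obtain ⟨i, hi⟩ := eq_inl_of_pow_eq_one hpq (x := f (σM φ)) (by
      rw [← map_pow, σM_pow_card, map_one])
    have h := mulAut_pow_σM hi p
    rw [hf, ZMod.pow_card] at h
    rw [hi, ← h, MulAut.one_apply]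
  refine ⟨hσ, toAdd (f (τM φ)).left, ?_⟩
  have hrel : τM φ * σM φ = inl (ofAdd g) * τM φ := by
    rw [σM, τM]
    ext
    · simp [action_one_eq hφ]
    · simp
  have h := congrArg f hrel
  rw [map_mul, map_mul, hσ, mulAut_apply_inl hσ, mul_one] at h
  have hl := congrArg (fun x => toAdd x.left) h
  rw [σM, mul_left, left_inl, mul_left, left_inl, right_inl, map_one φ, MulAut.one_apply,
    ← ofAdd_toAdd (f (τM φ)).right, hφ] at hl
  simp only [toAdd_mul, toAdd_ofAdd, mul_one] at hl
  rw [add_comm, add_left_inj] at hl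
  have hval : (toAdd (f (τM φ)).right).val = 1 := by
    have h₁ : g ^ (toAdd (f (τM φ)).right).val = g ^ 1 := by rw [hl, pow_one]
    have hg0 : IsOfFinOrder g := orderOf_pos_iff.mp (hg ▸ NeZero.pos q)
    rwa [hg0.pow_inj_mod, hg, Nat.mod_eq_of_lt (ZMod.val_lt _), Nat.mod_eq_of_lt this.out] at h₁
  have hr : (f (τM φ)).right = ofAdd 1 := by
    rw [← ofAdd_toAdd (f (τM φ)).right, ← ZMod.natCast_zmod_val (toAdd (f (τM φ)).right), hval,
      Nat.cast_one]
  exact (inl_left_mul_inr_right _).symm.trans (by rw [hr]; rfl)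

theorem exists_pow_eq_of_pow_eq_one [Fact p.Prime] [Fact q.Prime] (hpq : p.Coprime q)
    {g : ZMod p} (hg : orderOf g = q)
    (hφ : ∀ (m : ZMod q) (n : ZMod p), φ (ofAdd m) (ofAdd n) = ofAdd (g ^ m.val * n))
    {α f : MulAut (Multiplicative (ZMod p) ⋊[φ] Multiplicative (ZMod q))}
    (hα₁ : α (σM φ) = σM φ) (hα₂ : α (τM φ) = σM φ * τM φ)
    (hf : f ^ p = 1) (hf₁ : f ≠ 1) : ∃ k : ℕ, f ^ k = α := by
  obtain ⟨hσ, j, hτ⟩ := mulAut_apply_generators_of_pow_eq_one hpq hg hφ hf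
  have hj : j ≠ 0 := by
    rintro rfl
    refine hf₁ (mulAut_ext_generators hσ ?_)
    rw [hτ, ofAdd_zero, map_one, one_mul, MulAut.one_apply]
  refine ⟨(j⁻¹).val, mulAut_ext_generators ?_ ?_⟩
  · rw [hα₁, mulAut_pow_σM hσ, one_pow, σM]
  · rw [mulAut_pow_τM hσ hτ, ZMod.natCast_zmod_val, inv_mul_cancel₀ hj, hα₂, σM]

theorem eq_Gc_of_isRegularPermGroup [Fact p.Prime] [Fact q.Prime] (hpq : p.Coprime q)
    {g : ZMod p} (hg : orderOf g = q)
    (hφ : ∀ (m : ZMod q) (n : ZMod p), φ (ofAdd m) (ofAdd n) = ofAdd (g ^ m.val * n))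
    {a₀ : ZMod p} (ha : (g - 1) * a₀ = 1)
    {α : MulAut (Multiplicative (ZMod p) ⋊[φ] Multiplicative (ZMod q))}
    (hα₁ : α (σM φ) = σM φ) (hα₂ : α (τM φ) = σM φ * τM φ)
    {G : Subgroup (Equiv.Perm (Multiplicative (ZMod p) ⋊[φ] Multiplicative (ZMod q)))}
    (hG : (G : Set (Equiv.Perm (Multiplicative (ZMod p) ⋊[φ] Multiplicative (ZMod q)))) ⊆
      HolSet _)
    (hreg : IsRegularPermGroup G)
    (hcard : Nat.card (holPi2 ''
      (G : Set (Equiv.Perm (Multiplicative (ZMod p) ⋊[φ] Multiplicative (ZMod q))))) = p) :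
    ∃ c : ℕ, c ≤ p - 1 ∧ G = Gc φ α a₀ c := by
  have hp : p.Prime := Fact.out
  have hq : q.Prime := Fact.out
  have : Fact (1 < q) := ⟨hq.one_lt⟩
  obtain ⟨F, hF⟩ := exists_hom_of_subset_holSet G hG
  have hrange : Nat.card F.range = p := by
    have himage : holPi2 '' (G : Set (Equiv.Perm _)) =
        (fun (f : MulAut (Multiplicative (ZMod p) ⋊[φ] Multiplicative (ZMod q))) x => f x) ''
          (F.range : Set _) := by
      have hpi : ∀ k : G, holPi2 k.1 = fun x => F k x := fun k => by
        ext1 x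
        rw [holPi2, hF k x, inv_mul_cancel_left]
      ext f
      constructor
      · rintro ⟨k, hk, rfl⟩
        exact ⟨F ⟨k, hk⟩, ⟨_, rfl⟩, (hpi ⟨k, hk⟩).symm⟩
      · rintro ⟨_, ⟨k, rfl⟩, rfl⟩
        exact ⟨k, k.2, hpi k⟩
    rw [himage, Nat.card_image_of_injective DFunLike.coe_injective] at hcard
    exact hcard
  have hker : Nat.card F.ker = q := by
    have hZ : ∀ n : ℕ, Nat.card (Multiplicative (ZMod n)) = n := Nat.card_zmod
    have h := F.ker.card_mul_index
    rw [Subgroup.index_ker, hrange, hreg.natCard_eq, SemidirectProduct.card, hZ, hZ,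
      mul_comm] at h
    exact Nat.eq_of_mul_eq_mul_left hp.pos h
  have hker_apply : ∀ k ∈ F.ker, k.1 = Equiv.mulLeft (k.1 1) := fun k hk => by
    ext1 x
    rw [hF k x, MonoidHom.mem_ker.mp hk, MulAut.one_apply, Equiv.coe_mulLeft]
  have hker_pow : ∀ k ∈ F.ker, (k.1 1) ^ q = 1 := fun k hk => by
    have h₁ : k ^ q = 1 := by
      have := pow_card_eq_one' (x := (⟨k, hk⟩ : F.ker))
      rw [hker] at this
      exact congrArg Subtype.val this
    have h₂ : k.1 ^ q = 1 := congrArg Subtype.val h₁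
    rw [hker_apply k hk, Equiv.pow_mulLeft] at h₂
    simpa using DFunLike.congr_fun h₂ 1
  have hker_inl : ∀ k ∈ F.ker, ∀ n : ZMod p, k.1 1 = inl (ofAdd n) → n = 0 := by
    intro k hk n hn
    have h := hker_pow k hk
    rw [hn, ← map_pow, ← ofAdd_nsmul, ← map_one inl, inl_inj, ← ofAdd_zero, ofAdd.injective.eq_iff,
      nsmul_eq_mul, mul_eq_zero, ZMod.natCast_eq_zero_iff] at h
    exact h.resolve_left fun hd => hp.one_lt.ne' (Nat.Coprime.eq_one_of_dvd hpq hd)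
  obtain ⟨t, htker, c, ht⟩ : ∃ t ∈ F.ker, ∃ c : ZMod p, t.1 1 = inl (ofAdd c) * τM φ := by
    have : Nontrivial F.ker := nontrivial_of_prime_natCard (hker.symm ▸ hq)
    obtain ⟨⟨k, hk⟩, hk1⟩ := exists_ne (1 : F.ker)
    have hr : toAdd (k.1 1).right ≠ 0 := by
      intro h0
      have hx : k.1 1 = inl (ofAdd (toAdd (k.1 1).left)) := SemidirectProduct.ext rfl h0
      have hn := hker_inl k hk _ hx
      refine hk1 (Subtype.ext (Subtype.ext ?_))
      rw [hn, ofAdd_zero, map_one inl] at hx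
      change k.1 = 1
      rw [hker_apply k hk, hx, Equiv.mulLeft_one]
    refine ⟨k ^ ((toAdd (k.1 1).right)⁻¹).val, pow_mem hk _, ?_⟩
    have hk_pow : ∀ m : ℕ, (k ^ m).1 1 = k.1 1 ^ m := fun m => by
      rw [SubmonoidClass.coe_pow, hker_apply k hk, Equiv.pow_mulLeft]
      simp
    rw [hk_pow]
    generalize k.1 1 = y at hr ⊢
    refine ⟨toAdd (y ^ ((toAdd y.right)⁻¹).val).left,
      (inl_left_mul_inr_right _).symm.trans ?_⟩
    have hyr : (y ^ ((toAdd y.right)⁻¹).val).right = ofAdd 1 := by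
      rw [← rightHom_eq_right, map_pow, rightHom_eq_right, ← ofAdd_toAdd y.right, ← ofAdd_nsmul,
        nsmul_eq_mul, toAdd_ofAdd, ZMod.natCast_zmod_val, inv_mul_cancel₀ hr]
    rw [hyr]
    rfl
  obtain ⟨s₀, hs₀⟩ : ∃ s : G, F s = α := by
    have : Nontrivial F.range := nontrivial_of_prime_natCard (hrange.symm ▸ hp)
    obtain ⟨⟨f, hfr⟩, hf1⟩ := exists_ne (1 : F.range)
    have hfp : f ^ p = 1 := by
      have := pow_card_eq_one' (x := (⟨f, hfr⟩ : F.range))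
      rw [hrange] at this
      exact congrArg Subtype.val this
    obtain ⟨k, hk⟩ := exists_pow_eq_of_pow_eq_one hpq hg hφ hα₁ hα₂ hfp
      fun h => hf1 (Subtype.ext h)
    obtain ⟨s, rfl⟩ := hfr
    exact ⟨s ^ k, by rw [map_pow, hk]⟩
  obtain ⟨s, hsα, a, hs⟩ : ∃ s : G, F s = α ∧ ∃ a : ZMod p, s.1 1 = inl (ofAdd a) := by
    let m := (-toAdd (s₀.1 1).right).val
    refine ⟨t ^ m * s₀, ?_, toAdd ((t ^ m * s₀).1 1).left, SemidirectProduct.ext rfl ?_⟩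
    · rw [map_mul, map_pow, MonoidHom.mem_ker.mp htker, one_pow, one_mul, hs₀]
    · have hm : (t ^ m * s₀).1 1 = (inl (ofAdd c) * τM φ) ^ m * s₀.1 1 := by
        rw [Subgroup.coe_mul, SubmonoidClass.coe_pow, hker_apply t htker, Equiv.pow_mulLeft, ht]
        rfl
      rw [hm, mul_right, ← rightHom_eq_right, map_pow, map_mul, rightHom_inl, one_mul, τM,
        rightHom_inr, ← ofAdd_nsmul, nsmul_one, ZMod.natCast_zmod_val, rightHom_eq_right,
        right_inl, ofAdd_neg, ofAdd_toAdd, inv_mul_cancel]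
  have haa : a = a₀ := by
    have hmem : t⁻¹ * (s * t * s⁻¹) ∈ F.ker :=
      mul_mem (inv_mem htker) (F.normal_ker.conj_mem _ htker _)
    obtain ⟨k, hk⟩ : ∃ k, k = t⁻¹ * (s * t * s⁻¹) := ⟨_, rfl⟩
    rw [← hk] at hmem
    have hcomm : t * k * s = s * t := by rw [hk]; group
    have hτ : τM φ * (k.1 1 * inl (ofAdd a)) = inl (ofAdd (a + 1)) * τM φ := by
      have h₁ : (t * k * s).1 1 = inl (ofAdd c) * τM φ * (k.1 1 * inl (ofAdd a)) := by
        change t.1 (k.1 (s.1 1)) = _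
        rw [hs, hker_apply t htker, hker_apply k hmem, ht]
        simp [mul_assoc]
      have h₂ : (s * t).1 1 = inl (ofAdd a) * (inl (ofAdd c) * (σM φ * τM φ)) := by
        change s.1 (t.1 1) = _
        rw [hF s, hs, ht, hsα, map_mul, hα₂, mulAut_apply_inl hα₁, mul_one]
      rw [hcomm, h₂, σM, mul_assoc (inl (ofAdd c))] at h₁
      refine mul_left_cancel (h₁.symm.trans ?_)
      simp only [← mul_assoc, ← map_mul, ← ofAdd_add]
      congr 3
      ring_nf
    have hk_inl : k.1 1 = inl (ofAdd (toAdd (k.1 1).left)) := by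
      refine SemidirectProduct.ext rfl ?_
      have h := congrArg right hτ
      rw [τM] at h
      simpa using h
    rw [hk_inl, hker_inl k hmem _ hk_inl, ofAdd_zero, map_one, one_mul, τM] at hτ
    have h := congrArg (fun x => toAdd x.left) hτ
    simp [action_one_eq hφ] at h
    linear_combination a₀ * h - a * ha
  refine ⟨c.val, Nat.le_sub_one_of_lt (ZMod.val_lt c), ?_⟩
  refine IsRegularPermGroup.eq_of_le ?_ hreg ?_
  · rw [Gc_eq_range hφ ha hα₁ hα₂]
    exact isRegularPermGroup_range_twoSidedTranslation _
  · rw [Gc, Subgroup.closure_le, Set.pair_subset_iff, σM_pow, σM_pow, ZMod.natCast_zmod_val,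
      ZMod.natCast_zmod_val]
    constructor
    · have h : Equiv.mulLeft (inl (ofAdd a₀)) * α.toEquiv = s.1 := by
        ext1 x
        rw [hF s x, hs, hsα, haa]
        rfl
      rw [h]
      exact s.2
    · rw [← ht, ← hker_apply t htker]
      exact t.2

end Metacyclic

/-- Let `p > q` be primes with `p ≡ 1 (mod q)`, `M = ℤ_p ⋊_g ℤ_q`, `α = φ_{1,1}` and
`a₀` an inverse of `g - 1` mod `p`.  The regular subgroups of `Hol(M)` whose image
under `π₂` has size `p` are exactly `G_c = ⟨σ^{a₀}α, σ^c τ⟩` for `0 ≤ c ≤ p-1`, each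
isomorphic to the cyclic group of order `pq`; moreover each `G_c` is conjugate to `G_0`
via the automorphism `φ_{1,-c}` of `M`. -/
theorem stmt16 (p q : ℕ) (hp : p.Prime) (hq : q.Prime) (hlt : q < p)
    (hmod : p % q = 1) (g : ZMod p) (hg : orderOf g = q)
    (φ : Multiplicative (ZMod q) →* MulAut (Multiplicative (ZMod p)))
    (hφ : ∀ (m : ZMod q) (n : ZMod p),
      φ (Multiplicative.ofAdd m) (Multiplicative.ofAdd n) =
        Multiplicative.ofAdd (g ^ m.val * n))
    (a₀ : ZMod p) (ha : (g - 1) * a₀ = 1)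
    (α : MulAut (Multiplicative (ZMod p) ⋊[φ] Multiplicative (ZMod q)))
    (hα₁ : α (σM φ) = σM φ)
    (hα₂ : α (τM φ) = σM φ * τM φ) :
    (∀ G : Subgroup (Equiv.Perm (Multiplicative (ZMod p) ⋊[φ] Multiplicative (ZMod q))),
      ((G : Set (Equiv.Perm (Multiplicative (ZMod p) ⋊[φ] Multiplicative (ZMod q)))) ⊆
          HolSet _ ∧
        IsRegularPermGroup G ∧
        Nat.card (holPi2 ''
          (G : Set (Equiv.Perm (Multiplicative (ZMod p) ⋊[φ] Multiplicative (ZMod q))))) = p) ↔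
      (∃ c : ℕ, c ≤ p - 1 ∧ G = Gc φ α a₀ c)) ∧
    (∀ c : ℕ, c ≤ p - 1 →
      Nonempty ((Gc φ α a₀ c) ≃* Multiplicative (ZMod (p * q)))) ∧
    (∀ c : ℕ, c ≤ p - 1 →
      ∃ η : MulAut (Multiplicative (ZMod p) ⋊[φ] Multiplicative (ZMod q)),
        η (σM φ) = σM φ ∧ η (τM φ) = ((σM φ) ^ c)⁻¹ * τM φ ∧
        Subgroup.map (MulAut.conj η.toEquiv).toMonoidHom (Gc φ α a₀ c) =
          Gc φ α a₀ 0) := by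
  have := Fact.mk hp
  have := Fact.mk hq
  have : Fact (1 < q) := ⟨hq.one_lt⟩
  have hpq : p.Coprime q := (Nat.coprime_primes hp hq).mpr hlt.ne'
  refine ⟨fun G => ⟨fun ⟨hG, hreg, hcard⟩ =>
    eq_Gc_of_isRegularPermGroup hpq hg hφ ha hα₁ hα₂ hG hreg hcard, ?_⟩, fun c _ => ?_,
    fun c _ => ?_⟩
  · rintro ⟨c, -, rfl⟩
    rw [Gc_eq_range hφ ha hα₁ hα₂]
    exact ⟨range_twoSidedTranslation_subset_holSet _,
      isRegularPermGroup_range_twoSidedTranslation _, natCard_holPi2_image_range hφ ha _⟩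
  · rw [Gc_eq_range hφ ha hα₁ hα₂]
    exact ⟨(MonoidHom.ofInjective (twoSidedTranslation_injective _)).symm.trans
      ((MulEquiv.prodMultiplicative _ _).symm.trans
        (AddEquiv.toMultiplicative (ZMod.chineseRemainder hpq).toAddEquiv.symm))⟩
  · refine ⟨MulAut.conj (inl (ofAdd (-(a₀ * c))))⁻¹, ?_, ?_, ?_⟩
    · rw [← map_inv, conj_inl_σM]
    · rw [← map_inv, ← ofAdd_neg, conj_inl_τM hφ, σM_pow, ← map_inv, ← ofAdd_neg]
      congr 3
      linear_combination -c * ha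
    · rw [Gc_eq_range hφ ha hα₁ hα₂, Gc_eq_range hφ ha hα₁ hα₂,
        map_conj_range_twoSidedTranslation, Nat.cast_zero, mul_zero, neg_zero, ofAdd_zero, map_one]
end

section
/- Let p > q be primes with p ≡ 1 (mod q) and g of multiplicative order q mod p. Define on A = ℤ_p × ℤ_q the operations (n,m) + (s,t) = (n + g^m s, m+t) and (n,m) ∘ (s,t) = (g^t n + g^m s, m+t). Then (A, +, ∘) is a skew brace whose additive group is the non-abelian group ℤ_p ⋊_g ℤ_q and whose kernel of λ has order q. -/
theorem pow_val_add_of_pow_eq_one {M : Type*} [Monoid M] {q : ℕ} {g : M}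
    (hg : g ^ q = 1) [NeZero q] (a b : ZMod q) :
    g ^ (a + b).val = g ^ a.val * g ^ b.val := by
  rw [ZMod.val_add, ← pow_add]
  exact (pow_eq_pow_mod _ hg).symm

theorem pow_mul_pow_sub_val_of_pow_eq_one {M : Type*} [Monoid M] {q : ℕ} {g : M}
    (hg : g ^ q = 1) [NeZero q] (a : ZMod q) : g ^ a.val * g ^ (q - a.val) = 1 := by
  rw [← pow_add, Nat.add_sub_cancel' (ZMod.val_lt a).le, hg]

theorem pow_val_neg_of_pow_eq_one {M : Type*} [Monoid M] {q : ℕ} {g : M}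
    (hg : g ^ q = 1) [NeZero q] (a : ZMod q) : g ^ (-a).val = g ^ (q - a.val) := by
  rw [ZMod.neg_val']
  exact (pow_eq_pow_mod _ hg).symm

/-- Let `p > q` be primes with `p ≡ 1 (mod q)` and `g` of multiplicative order `q`
mod `p`.  On `A = ℤ_p × ℤ_q` with `(n,m) + (s,t) = (n + g^m s, m+t)` (so `(A,+)` is the
non-abelian group `ℤ_p ⋊_g ℤ_q`) and `(n,m) ∘ (s,t) = (g^t n + g^m s, m+t)`, the triple
`(A,+,∘)` is a skew brace whose kernel of `λ` (i.e. `{a | ∀ b, a ∘ b = a + b}`) has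
order `q`. -/
theorem stmt17 (p q : ℕ) (hp : p.Prime) (hq : q.Prime) (hlt : q < p)
    (hmod : p % q = 1) (g : ZMod p) (hg : orderOf g = q) :
    IsSkewBrace
      (fun x y : ZMod p × ZMod q => (x.1 + g ^ x.2.val * y.1, x.2 + y.2)) 0
      (fun x : ZMod p × ZMod q => (-(g ^ (q - x.2.val) * x.1), -x.2))
      (fun x y : ZMod p × ZMod q =>
        (g ^ y.2.val * x.1 + g ^ x.2.val * y.1, x.2 + y.2)) 0
      (fun x : ZMod p × ZMod q => (-(g ^ (2 * (q - x.2.val)) * x.1), -x.2)) ∧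
    Nat.card {a : ZMod p × ZMod q | ∀ b : ZMod p × ZMod q,
      (g ^ b.2.val * a.1 + g ^ a.2.val * b.1, a.2 + b.2) =
        (a.1 + g ^ a.2.val * b.1, a.2 + b.2)} = q := by
  have : Fact p.Prime := ⟨hp⟩
  have : Fact q.Prime := ⟨hq⟩
  have hgq : g ^ q = 1 := hg ▸ pow_orderOf_eq_one g
  have hadd := pow_val_add_of_pow_eq_one hgq
  have hneg := pow_val_neg_of_pow_eq_one hgq
  have hinv := pow_mul_pow_sub_val_of_pow_eq_one hgq
  have hg1 : g ≠ 1 := fun h => hq.ne_one (by rw [← hg, h, orderOf_one])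
  refine ⟨⟨⟨?_, ?_, ?_, ?_, ?_⟩, ⟨?_, ?_, ?_, ?_, ?_⟩, ?_⟩, ?_⟩
  · rintro ⟨n, m⟩ ⟨s, t⟩ ⟨u, v⟩
    ext
    · simp only [hadd]; ring
    · exact add_assoc _ _ _
  · rintro ⟨n, m⟩
    simp
  · rintro ⟨n, m⟩
    simp
  · rintro ⟨n, m⟩
    simp [hneg]
  · rintro ⟨n, m⟩
    ext
    · simp only [Prod.fst_zero]
      linear_combination (-n) * hinv m
    · simp
  · rintro ⟨n, m⟩ ⟨s, t⟩ ⟨u, v⟩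
    ext
    · simp only [hadd]; ring
    · exact add_assoc _ _ _
  · rintro ⟨n, m⟩
    simp
  · rintro ⟨n, m⟩
    simp
  · rintro ⟨n, m⟩
    ext
    · simp only [hneg, Prod.fst_zero, mul_comm 2, pow_mul]
      linear_combination (-n * g ^ (q - m.val)) * hinv m
    · simp
  · rintro ⟨n, m⟩
    ext
    · simp only [hneg, Prod.fst_zero, mul_comm 2, pow_mul]
      linear_combination (-n * g ^ (q - m.val)) * hinv m
    · simp
  · rintro ⟨n, m⟩ ⟨s, t⟩ ⟨u, v⟩
    ext
    · simp only [hadd, hneg]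
      linear_combination
        (n * g ^ t.val - g ^ t.val * (g ^ v.val * n + g ^ m.val * u)) * hinv m
    · simp only; ring
  · have hker : {a : ZMod p × ZMod q | ∀ b : ZMod p × ZMod q,
        (g ^ b.2.val * a.1 + g ^ a.2.val * b.1, a.2 + b.2) =
          (a.1 + g ^ a.2.val * b.1, a.2 + b.2)} = {0} ×ˢ Set.univ := by
      ext ⟨n, m⟩
      simp only [Set.mem_ofPred_eq, Set.mem_prod, Set.mem_singleton_iff, Set.mem_univ,
        and_true, Prod.mk.injEq, add_left_inj]
      constructor
      · intro h
        have h1 := h (0, 1)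
        rw [ZMod.val_one, pow_one] at h1
        exact (mul_left_eq_self₀.mp h1).resolve_left hg1
      · rintro rfl b
        simp
    rw [hker, Nat.card_coe_set_eq, Set.ncard_prod]
    simp [Set.ncard_univ]
end
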